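/- arXiv:2009.03760 — 4 statements merged into one kernel-verified Lean document; each statement's English description precedes it below -/
import Mathlib

section
/- Let (g, [·,·], α, β) be a BiHom-Lie superalgebra. Then the free ℤ₂-graded ℂ[∂]-module Cur g = ℂ[∂] ⊗ g, with (Cur g)_θ = ℂ[∂] ⊗ g_θ, the maps α(f(∂) ⊗ a) = f(∂) ⊗ α(a) and β(f(∂) ⊗ a) = f(∂) ⊗ β(a), and the λ-bracket [(f(∂) ⊗ a)_λ (g(∂) ⊗ b)] = f(−λ) g(∂+λ) ⊗ [a, b], is a BiHom-Lie conformal superalgebra. -/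
/- ## Conventions

A (ℤ₂-graded) `ℂ[∂]`-module is a complex vector space `R` together with
`D : Module.End ℂ R` (the action of `∂`) and a grading `G : ZMod 2 → Submodule ℂ R`
which is an internal direct sum decomposition.

A `λ`-bracket `R ⊗ R → ℂ[λ] ⊗ R` is encoded by its coefficients:
`br : ℕ → R → R → R`, where `[a_λ b] = ∑ₙ λⁿ • br n a b` (a finite sum, by the
`locality` axiom which expresses that the values really lie in `ℂ[λ] ⊗ R`).
All axioms of the various kinds of conformal superalgebras are expressed below by
comparing coefficients of the polynomial identities in `λ` (and `μ`). -/

noncomputable section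

open Finset

/-- The super-sign `(-1)^{|i||j|}`. -/
def sgn (i j : ZMod 2) : ℂ := (-1 : ℂ) ^ (i.val * j.val)

/-- `prev g n = g (n-1)`, with the convention that it vanishes for `n = 0`.
If `g` lists the coefficients of a polynomial `p(λ)`, then `prev g` lists the
coefficients of `λ * p(λ)`. -/
def prev {M : Type*} [Zero M] (g : ℕ → M) : ℕ → M
  | 0 => 0
  | n + 1 => g n

/-- If `g` lists the coefficients of a polynomial `p(λ)` with coefficients in the
`ℂ[∂]`-module `(M, DM)`, then `nsub DM g` lists the coefficients of `p(-λ-∂)`. -/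
def nsub {M : Type*} [AddCommGroup M] [Module ℂ M] (DM : Module.End ℂ M)
    (g : ℕ → M) (n : ℕ) : M :=
  ∑ᶠ j : ℕ, (((-1 : ℂ) ^ (n + j)) * ((n + j).choose n : ℂ)) • (DM ^ j) (g (n + j))

/-- Bilinearity (over `ℂ`) of a `λ`-product with coefficients `br`. -/
structure IsBil {R M : Type*} [AddCommGroup R] [Module ℂ R] [AddCommGroup M] [Module ℂ M]
    (br : ℕ → R → M → M) : Prop where
  add_left : ∀ (n : ℕ) (a b : R) (v : M), br n (a + b) v = br n a v + br n b v
  smul_left : ∀ (n : ℕ) (t : ℂ) (a : R) (v : M), br n (t • a) v = t • br n a v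
  add_right : ∀ (n : ℕ) (a : R) (v w : M), br n a (v + w) = br n a v + br n a w
  smul_right : ∀ (n : ℕ) (t : ℂ) (a : R) (v : M), br n a (t • v) = t • br n a v

/-- A Lie conformal superalgebra structure on the ℤ₂-graded `ℂ[∂]`-module `(R, G, D)` with
`λ`-bracket coefficients `br` (`[a_λ b] = ∑ₙ λⁿ • br n a b`):
conformal sesquilinearity `[(∂a)_λ b] = -λ[a_λ b]`, skew-symmetry
`[a_λ b] = -(-1)^{|a||b|} [b_{-λ-∂} a]` and the Jacobi identity
`[a_λ [b_μ c]] = [[a_λ b]_{λ+μ} c] + (-1)^{|a||b|} [b_μ [a_λ c]]`,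
all written out in coefficients of `λ^n μ^m`. -/
structure IsLieConfSuperAlg {R : Type*} [AddCommGroup R] [Module ℂ R]
    (G : ZMod 2 → Submodule ℂ R) (D : Module.End ℂ R) (br : ℕ → R → R → R) : Prop where
  internal : DirectSum.IsInternal G
  der_even : ∀ (i : ZMod 2) (a : R), a ∈ G i → D a ∈ G i
  bil : IsBil br
  grade : ∀ (i j : ZMod 2) (n : ℕ) (a b : R), a ∈ G i → b ∈ G j → br n a b ∈ G (i + j)
  locality : ∀ a b, ∃ N, ∀ n ≥ N, br n a b = 0
  sesq : ∀ (n : ℕ) (a b : R), br n (D a) b = - prev (fun m => br m a b) n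
  skew : ∀ (i j : ZMod 2) (n : ℕ) (a b : R), a ∈ G i → b ∈ G j →
    br n a b = -(sgn i j) • nsub D (fun m => br m b a) n
  jacobi : ∀ (i j : ZMod 2) (m n : ℕ) (a b c : R), a ∈ G i → b ∈ G j →
    br m a (br n b c) =
      (∑ s ∈ range (m + 1), (((n + s).choose s : ℂ)) • br (n + s) (br (m - s) a b) c)
      + sgn i j • br n b (br m a c)

/-- A BiHom-Lie conformal superalgebra structure on `(R, G, D)` with structure maps
`al`, `be` and `λ`-bracket coefficients `br`. The axioms are those of the definition:
`α∂ = ∂α`, `β∂ = ∂β`, `α` and `β` commute, are even, and preserve the bracket;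
conformal sesquilinearity `[(∂a)_λ b] = -λ[a_λ b]`, `[a_λ (∂b)] = (∂+λ)[a_λ b]`;
BiHom-skew-symmetry `[β(a)_λ α(b)] = -(-1)^{|a||b|} [β(b)_{-λ-∂} α(a)]`; and the
BiHom-Jacobi identity
`[αβ(a)_λ [b_μ c]] = [[β(a)_λ b]_{λ+μ} β(c)] + (-1)^{|a||b|} [β(b)_μ [α(a)_λ c]]`,
written out in coefficients. -/
structure IsBiHomLieConfSuperAlg {R : Type*} [AddCommGroup R] [Module ℂ R]
    (G : ZMod 2 → Submodule ℂ R) (D : Module.End ℂ R)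
    (al be : Module.End ℂ R) (br : ℕ → R → R → R) : Prop where
  internal : DirectSum.IsInternal G
  der_even : ∀ (i : ZMod 2) (a : R), a ∈ G i → D a ∈ G i
  al_even : ∀ (i : ZMod 2) (a : R), a ∈ G i → al a ∈ G i
  be_even : ∀ (i : ZMod 2) (a : R), a ∈ G i → be a ∈ G i
  al_be_comm : ∀ a, al (be a) = be (al a)
  al_der : ∀ a, al (D a) = D (al a)
  be_der : ∀ a, be (D a) = D (be a)
  bil : IsBil br
  grade : ∀ (i j : ZMod 2) (n : ℕ) (a b : R), a ∈ G i → b ∈ G j → br n a b ∈ G (i + j)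
  locality : ∀ a b, ∃ N, ∀ n ≥ N, br n a b = 0
  al_br : ∀ (n : ℕ) (a b : R), al (br n a b) = br n (al a) (al b)
  be_br : ∀ (n : ℕ) (a b : R), be (br n a b) = br n (be a) (be b)
  sesq₁ : ∀ (n : ℕ) (a b : R), br n (D a) b = - prev (fun m => br m a b) n
  sesq₂ : ∀ (n : ℕ) (a b : R), br n a (D b) = D (br n a b) + prev (fun m => br m a b) n
  skew : ∀ (i j : ZMod 2) (n : ℕ) (a b : R), a ∈ G i → b ∈ G j →
    br n (be a) (al b) = -(sgn i j) • nsub D (fun m => br m (be b) (al a)) n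
  jacobi : ∀ (i j : ZMod 2) (m n : ℕ) (a b c : R), a ∈ G i → b ∈ G j →
    br m (al (be a)) (br n b c) =
      (∑ s ∈ range (m + 1), (((n + s).choose s : ℂ)) • br (n + s) (br (m - s) (be a) b) (be c))
      + sgn i j • br n (be b) (br m (al a) c)

/-- A BiHom-Lie superalgebra structure on the ℤ₂-graded vector space `(L, Gsup)` with
bracket `bkt` and structure maps `al`, `be`: the maps are even, commute, preserve the
bracket, and satisfy BiHom-skew-symmetry `[β(a), α(b)] = −(−1)^{|a||b|}[β(b), α(a)]` and
the BiHom-Jacobi identity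
`[αβ(a), [b, c]] = [[β(a), b], β(c)] + (−1)^{|a||b|}[β(b), [α(a), c]]`. -/
structure IsBiHomLieSuperAlg {L : Type*} [AddCommGroup L] [Module ℂ L]
    (Gsup : ZMod 2 → Submodule ℂ L) (bkt : L → L → L) (al be : Module.End ℂ L) : Prop where
  internal : DirectSum.IsInternal Gsup
  add_left : ∀ (a b c : L), bkt (a + b) c = bkt a c + bkt b c
  smul_left : ∀ (t : ℂ) (a c : L), bkt (t • a) c = t • bkt a c
  add_right : ∀ (a b c : L), bkt a (b + c) = bkt a b + bkt a c
  smul_right : ∀ (t : ℂ) (a c : L), bkt a (t • c) = t • bkt a c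
  grade : ∀ (i j : ZMod 2) (a b : L), a ∈ Gsup i → b ∈ Gsup j → bkt a b ∈ Gsup (i + j)
  al_even : ∀ (i : ZMod 2) (a : L), a ∈ Gsup i → al a ∈ Gsup i
  be_even : ∀ (i : ZMod 2) (a : L), a ∈ Gsup i → be a ∈ Gsup i
  al_be_comm : ∀ a, al (be a) = be (al a)
  al_bkt : ∀ a b, al (bkt a b) = bkt (al a) (al b)
  be_bkt : ∀ a b, be (bkt a b) = bkt (be a) (be b)
  skew : ∀ (i j : ZMod 2) (a b : L), a ∈ Gsup i → b ∈ Gsup j →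
    bkt (be a) (al b) = -(sgn i j) • bkt (be b) (al a)
  jacobi : ∀ (i j : ZMod 2) (a b c : L), a ∈ Gsup i → b ∈ Gsup j →
    bkt (al (be a)) (bkt b c) = bkt (bkt (be a) b) (be c) + sgn i j • bkt (be b) (bkt (al a) c)

section CurrentBracket

open Polynomial

theorem prev_eventually_zero {M : Type*} [Zero M] {g : ℕ → M} (hg : ∃ N, ∀ n ≥ N, g n = 0) :
    ∃ N, ∀ n ≥ N, prev g n = 0 := by
  obtain ⟨N, hN⟩ := hg
  refine ⟨N + 1, fun n hn => ?_⟩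
  obtain ⟨k, rfl⟩ : ∃ k, n = k + 1 := ⟨n - 1, by omega⟩
  exact hN k (by omega)

section Coefficients

variable {M : Type*} [AddCommGroup M] [Module ℂ M]

theorem nsub_eq_sum (D : Module.End ℂ M) {g : ℕ → M} {N : ℕ} (hN : ∀ n ≥ N, g n = 0) (n : ℕ) :
    nsub D g n = ∑ j ∈ range N,
      (((-1 : ℂ) ^ (n + j)) * ((n + j).choose n : ℂ)) • (D ^ j) (g (n + j)) := by
  refine finsum_eq_sum_of_support_subset _ fun j hj => ?_
  by_contra h
  simp only [coe_range, Set.mem_Iio, not_lt] at h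
  exact hj (by simp only [hN (n + j) (by omega), map_zero, smul_zero])

theorem nsub_add (D : Module.End ℂ M) {g h : ℕ → M} (hg : ∃ N, ∀ n ≥ N, g n = 0)
    (hh : ∃ N, ∀ n ≥ N, h n = 0) (n : ℕ) :
    nsub D (fun m => g m + h m) n = nsub D g n + nsub D h n := by
  obtain ⟨N, hN⟩ := hg
  obtain ⟨K, hK⟩ := hh
  have hN' : ∀ n ≥ max N K, g n = 0 := fun n hn => hN n (le_trans (le_max_left _ _) hn)
  have hK' : ∀ n ≥ max N K, h n = 0 := fun n hn => hK n (le_trans (le_max_right _ _) hn)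
  rw [nsub_eq_sum D hN', nsub_eq_sum D hK',
    nsub_eq_sum D (N := max N K) fun n hn => by rw [hN' n hn, hK' n hn, add_zero]]
  simp only [map_add, smul_add, sum_add_distrib]

theorem nsub_map {M' : Type*} [AddCommGroup M'] [Module ℂ M'] {D : Module.End ℂ M}
    {D' : Module.End ℂ M'} (φ : M →ₗ[ℂ] M') (hφ : ∀ x, φ (D x) = D' (φ x))
    {g : ℕ → M} (hg : ∃ N, ∀ n ≥ N, g n = 0) (n : ℕ) :
    nsub D' (fun m => φ (g m)) n = φ (nsub D g n) := by
  obtain ⟨N, hN⟩ := hg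
  have hpow : ∀ (j : ℕ) (x : M), (D' ^ j) (φ x) = φ ((D ^ j) x) := by
    intro j
    induction j with
    | zero => intro x; rfl
    | succ j ih => intro x; rw [pow_succ, pow_succ, Module.End.mul_apply, ← hφ, ih]; rfl
  rw [nsub_eq_sum D hN, nsub_eq_sum D' (N := N) fun n hn => by rw [hN n hn, map_zero]]
  simp only [map_sum, map_smul, hpow]

/-- Substituting `-λ-∂` for `λ` turns `λ p(λ)` into `(-λ-∂) p(-λ-∂)`. -/
theorem nsub_prev (D : Module.End ℂ M) {g : ℕ → M} (hg : ∃ N, ∀ n ≥ N, g n = 0) (n : ℕ) :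
    nsub D (prev g) n = -prev (nsub D g) n - D (nsub D g n) := by
  obtain ⟨N, hN⟩ := hg
  have hN' : ∀ n ≥ N + 1, prev g n = 0 := by
    intro n hn
    obtain ⟨k, rfl⟩ : ∃ k, n = k + 1 := ⟨n - 1, by omega⟩
    exact hN k (by omega)
  rw [nsub_eq_sum D hN', nsub_eq_sum D hN]
  cases n with
  | zero =>
    rw [sum_range_succ']
    simp only [prev, zero_add, Nat.choose_zero_right, Nat.cast_one, mul_one, map_zero, smul_zero,
      add_zero, neg_zero, zero_sub, map_sum, map_smul, pow_succ' D, Module.End.mul_apply,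
      ← sum_neg_distrib, ← neg_smul]
    refine sum_congr rfl fun j _ => ?_
    rw [pow_succ (-1 : ℂ), mul_neg_one, Nat.add_eq, zero_add]
  | succ n =>
    have h1 : prev (nsub D g) (n + 1) = ∑ j ∈ range (N + 1),
        (((-1 : ℂ) ^ (n + j)) * ((n + j).choose n : ℂ)) • (D ^ j) (g (n + j)) :=
      nsub_eq_sum D (fun m hm => hN m (by omega)) n
    have h2 : D (∑ j ∈ range N, (((-1 : ℂ) ^ (n + 1 + j)) * ((n + 1 + j).choose (n + 1) : ℂ)) •
          (D ^ j) (g (n + 1 + j))) = ∑ j ∈ range (N + 1),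
        (((-1 : ℂ) ^ (n + j)) * ((n + j).choose (n + 1) : ℂ)) • (D ^ j) (g (n + j)) := by
      rw [sum_range_succ']
      simp only [map_sum, map_smul, add_zero, Nat.choose_succ_self, Nat.cast_zero, mul_zero,
        zero_smul, pow_succ' D, Module.End.mul_apply]
      refine sum_congr rfl fun j _ => ?_
      rw [show n + 1 + j = n + (j + 1) by omega]
    rw [h1, h2, ← sum_neg_distrib, ← sum_sub_distrib]
    refine sum_congr rfl fun j _ => ?_
    rw [show n + 1 + j = (n + j) + 1 by omega, Nat.choose_succ_succ', prev, ← neg_smul, ← sub_smul]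
    congr 1
    push_cast
    ring

end Coefficients

theorem hasseDeriv_X_mul (k : ℕ) (q : ℂ[X]) :
    hasseDeriv k (X * q) = X * hasseDeriv k q + prev (fun m => hasseDeriv m q) k := by
  cases k with
  | zero => simp [prev]
  | succ k =>
    ext n
    cases n with
    | zero => simp [prev, hasseDeriv_coeff, coeff_X_mul]
    | succ n =>
      simp only [prev, hasseDeriv_coeff, coeff_add, coeff_X_mul]
      rw [show n + 1 + (k + 1) = (n + (k + 1)) + 1 by omega, coeff_X_mul,
        show n + 1 + k = n + (k + 1) by omega, Nat.choose_succ_succ']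
      push_cast
      ring

/-- The coefficient of `λ^n` in `f(-λ) q(∂+λ)`. -/
def curCoeff (n : ℕ) (f q : ℂ[X]) : ℂ[X] :=
  ∑ i ∈ range (n + 1), ((-1 : ℂ) ^ i * f.coeff i) • hasseDeriv (n - i) q

theorem curCoeff_add_left (n : ℕ) (f f' q : ℂ[X]) :
    curCoeff n (f + f') q = curCoeff n f q + curCoeff n f' q := by
  simp only [curCoeff, coeff_add, mul_add, add_smul, sum_add_distrib]

theorem curCoeff_add_right (n : ℕ) (f q q' : ℂ[X]) :
    curCoeff n f (q + q') = curCoeff n f q + curCoeff n f q' := by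
  simp only [curCoeff, map_add, smul_add, sum_add_distrib]

theorem curCoeff_smul_left (n : ℕ) (t : ℂ) (f q : ℂ[X]) :
    curCoeff n (t • f) q = t • curCoeff n f q := by
  simp only [curCoeff, coeff_smul, smul_sum, smul_smul, smul_eq_mul]
  exact sum_congr rfl fun i _ => by congr 1; ring

theorem curCoeff_smul_right (n : ℕ) (t : ℂ) (f q : ℂ[X]) :
    curCoeff n f (t • q) = t • curCoeff n f q := by
  simp only [curCoeff, map_smul, smul_sum]
  exact sum_congr rfl fun i _ => smul_comm _ _ _

/-- `curCoeff` as a bilinear map. -/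
def curCoeffₗ (n : ℕ) : ℂ[X] →ₗ[ℂ] ℂ[X] →ₗ[ℂ] ℂ[X] :=
  LinearMap.mk₂ ℂ (curCoeff n) (curCoeff_add_left n) (curCoeff_smul_left n)
    (curCoeff_add_right n) fun t f q => curCoeff_smul_right n t f q

theorem curCoeffₗ_apply (n : ℕ) (f q : ℂ[X]) : curCoeffₗ n f q = curCoeff n f q := rfl

theorem curCoeffₗ_eventually_zero (f q : ℂ[X]) : ∃ N, ∀ n ≥ N, curCoeffₗ n f q = 0 := by
  refine ⟨f.natDegree + q.natDegree + 1, fun n hn => ?_⟩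
  rw [curCoeffₗ_apply, curCoeff]
  refine sum_eq_zero fun i hi => ?_
  by_cases h : f.natDegree < i
  · rw [coeff_eq_zero_of_natDegree_lt h, mul_zero, zero_smul]
  · rw [hasseDeriv_eq_zero_of_lt_natDegree q (n - i) (by omega), smul_zero]

theorem curCoeffₗ_one_left (n : ℕ) (q : ℂ[X]) : curCoeffₗ n 1 q = hasseDeriv n q := by
  rw [curCoeffₗ_apply, curCoeff, sum_range_succ', sum_eq_zero]
  · simp
  · intro i _
    simp [coeff_one]

theorem curCoeffₗ_X_mul_left (n : ℕ) (f q : ℂ[X]) :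
    curCoeffₗ n (X * f) q = -prev (fun m => curCoeffₗ m f q) n := by
  cases n with
  | zero => simp [curCoeffₗ_apply, curCoeff, prev]
  | succ n =>
    simp only [prev, curCoeffₗ_apply, curCoeff]
    rw [sum_range_succ']
    simp only [coeff_X_mul, coeff_X_mul_zero, mul_zero, zero_smul, add_zero, ← sum_neg_distrib,
      ← neg_smul]
    refine sum_congr rfl fun i _ => ?_
    rw [show n + 1 - (i + 1) = n - i by omega]
    congr 1
    ring

theorem curCoeffₗ_X_mul_right (n : ℕ) (f q : ℂ[X]) :
    curCoeffₗ n f (X * q) = X * curCoeffₗ n f q + prev (fun m => curCoeffₗ m f q) n := by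
  simp only [curCoeffₗ_apply]
  rw [curCoeff, curCoeff, mul_sum]
  simp only [hasseDeriv_X_mul, smul_add, sum_add_distrib, mul_smul_comm]
  congr 1
  cases n with
  | zero => simp [prev]
  | succ n =>
    rw [sum_range_succ, Nat.sub_self]
    simp only [prev, smul_zero, add_zero, curCoeff]
    refine sum_congr rfl fun i hi => ?_
    rw [show n + 1 - i = (n - i) + 1 by have := mem_range.mp hi; omega]

/-- Induction for linear statements on `ℂ[X]`. -/
theorem polynomial_induction_X_mul {P : ℂ[X] → Prop} (one : P 1)
    (add : ∀ f f', P f → P f' → P (f + f')) (smul : ∀ (t : ℂ) f, P f → P (t • f))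
    (X_mul : ∀ f, P f → P (X * f)) (f : ℂ[X]) : P f := by
  induction f using Polynomial.induction_on' with
  | add f f' hf hf' => exact add f f' hf hf'
  | monomial n t =>
    rw [← C_mul_X_pow_eq_monomial, ← smul_eq_C_mul]
    refine smul t _ ?_
    induction n with
    | zero => simpa using one
    | succ n ih => rw [pow_succ']; exact X_mul _ ih

theorem nsub_smul {M : Type*} [AddCommGroup M] [Module ℂ M] (D : Module.End ℂ M) {g : ℕ → M}
    (hg : ∃ N, ∀ n ≥ N, g n = 0) (t : ℂ) (n : ℕ) :
    nsub D (fun m => t • g m) n = t • nsub D g n :=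
  nsub_map (D := D) (t • LinearMap.id) (fun x => by simp) hg n

theorem curCoeffₗ_skew (f q : ℂ[X]) (n : ℕ) :
    curCoeffₗ n f q =
      nsub (LinearMap.mulLeft ℂ (X : ℂ[X])) (fun m => curCoeffₗ m q f) n := by
  set D := LinearMap.mulLeft ℂ (X : ℂ[X]) with hD
  induction f using polynomial_induction_X_mul generalizing n with
  | one =>
    induction q using polynomial_induction_X_mul generalizing n with
    | one =>
      simp only [curCoeffₗ_one_left]
      have h : ∀ m ≥ 1, hasseDeriv m (1 : ℂ[X]) = 0 := fun m hm =>
        hasseDeriv_apply_one m hm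
      rw [nsub_eq_sum D h]
      rcases Nat.eq_zero_or_pos n with rfl | hn
      · simp
      · simp [h n hn]
    | add q q' h h' =>
      simp only [map_add, LinearMap.add_apply]
      rw [nsub_add D (curCoeffₗ_eventually_zero _ _) (curCoeffₗ_eventually_zero _ _), h, h']
    | smul t q h =>
      simp only [map_smul, LinearMap.smul_apply]
      rw [nsub_smul D (curCoeffₗ_eventually_zero _ _), h]
    | X_mul q h =>
      have e : (fun m => curCoeffₗ m (X * q) 1) =
          fun m => (-1 : ℂ) • prev (fun m => curCoeffₗ m q 1) m := by
        funext m; rw [curCoeffₗ_X_mul_left, neg_one_smul]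
      rw [e, nsub_smul D (prev_eventually_zero (curCoeffₗ_eventually_zero _ _)),
        nsub_prev D (curCoeffₗ_eventually_zero _ _), curCoeffₗ_X_mul_right, ← h, ← funext h,
        hD, LinearMap.mulLeft_apply, neg_one_smul]
      ring
  | add f f' h h' =>
    simp only [map_add, LinearMap.add_apply]
    rw [nsub_add D (curCoeffₗ_eventually_zero _ _) (curCoeffₗ_eventually_zero _ _), h, h']
  | smul t f h =>
    simp only [map_smul, LinearMap.smul_apply]
    rw [nsub_smul D (curCoeffₗ_eventually_zero _ _), h]
  | X_mul f h =>
    have e : (fun m => curCoeffₗ m q (X * f)) =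
        fun m => D (curCoeffₗ m q f) + prev (fun m => curCoeffₗ m q f) m := by
      funext m; rw [curCoeffₗ_X_mul_right]; rfl
    have h0 := curCoeffₗ_eventually_zero q f
    rw [e, nsub_add D (by obtain ⟨N, hN⟩ := h0; exact ⟨N, fun n hn => by rw [hN n hn, map_zero]⟩)
      (prev_eventually_zero h0), nsub_map (D := D) D (fun _ => rfl) h0, nsub_prev D h0,
      curCoeffₗ_X_mul_left, ← funext h]
    ring

theorem curCoeffₗ_left_comm (f q r : ℂ[X]) (m n : ℕ) :
    curCoeffₗ m f (curCoeffₗ n q r) = curCoeffₗ n q (curCoeffₗ m f r) := by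
  have h : ∀ k l : ℕ, hasseDeriv k (hasseDeriv l r) = hasseDeriv l (hasseDeriv k r) := by
    intro k l
    have h1 := LinearMap.congr_fun (hasseDeriv_comp (R := ℂ) k l) r
    have h2 := LinearMap.congr_fun (hasseDeriv_comp (R := ℂ) l k) r
    simp only [LinearMap.comp_apply] at h1 h2
    rw [h1, h2, add_comm l k, Nat.choose_symm_add]
  simp only [curCoeffₗ_apply, curCoeff, map_sum, map_smul, smul_sum]
  rw [sum_comm]
  refine sum_congr rfl fun i _ => sum_congr rfl fun j _ => ?_
  rw [h, smul_comm]

theorem curCoeffₗ_assoc (f q r : ℂ[X]) (m n : ℕ) :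
    curCoeffₗ m f (curCoeffₗ n q r) =
      ∑ s ∈ range (m + 1), ((n + s).choose s : ℂ) •
        curCoeffₗ (n + s) (curCoeffₗ (m - s) f q) r := by
  induction f using polynomial_induction_X_mul generalizing m n with
  | one =>
    simp only [curCoeffₗ_one_left]
    induction q using polynomial_induction_X_mul generalizing m n with
    | one =>
      rw [curCoeffₗ_one_left, sum_range_succ, sum_eq_zero]
      · have h1 := LinearMap.congr_fun (hasseDeriv_comp (R := ℂ) m n) r
        simp only [LinearMap.comp_apply] at h1
        rw [h1]
        simp [curCoeffₗ_one_left, add_comm m n, Nat.cast_smul_eq_nsmul]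
      · intro s hs
        rw [hasseDeriv_eq_zero_of_lt_natDegree (1 : ℂ[X]) (m - s)
          (by have := mem_range.mp hs; simp; omega)]
        simp
    | add q q' h h' =>
      simp only [map_add, LinearMap.add_apply, smul_add, sum_add_distrib, h, h']
    | smul t q h =>
      simp only [map_smul, LinearMap.smul_apply, h, smul_sum]
      exact sum_congr rfl fun _ _ => smul_comm _ _ _
    | X_mul q h =>
      rw [curCoeffₗ_X_mul_left]
      simp only [hasseDeriv_X_mul, map_add, LinearMap.add_apply, smul_add, sum_add_distrib,
        curCoeffₗ_X_mul_left]
      have hshift : ∑ s ∈ range (m + 1), ((n + s).choose s : ℂ) •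
            curCoeffₗ (n + s) (prev (fun k => hasseDeriv k q) (m - s)) r =
          ∑ s ∈ range m, ((n + s).choose s : ℂ) •
            curCoeffₗ (n + s) (hasseDeriv (m - (s + 1)) q) r := by
        rw [sum_range_succ, Nat.sub_self]
        simp only [prev, map_zero, LinearMap.zero_apply, smul_zero, add_zero]
        refine sum_congr rfl fun s hs => ?_
        rw [show m - s = (m - (s + 1)) + 1 by have := mem_range.mp hs; omega]
      rw [hshift]
      cases n with
      | zero =>
        rw [sum_range_succ']
        simp [prev, ← add_assoc]
      | succ n =>
        simp only [prev, map_neg, h]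
        rw [sum_range_succ', sum_range_succ' _ m]
        simp only [add_zero, Nat.choose_zero_right, Nat.cast_one, one_smul, neg_add, smul_neg,
          sum_neg_distrib]
        rw [add_right_comm, ← sum_neg_distrib, ← sum_neg_distrib, ← sum_add_distrib]
        congr 1
        refine sum_congr rfl fun s _ => ?_
        rw [Nat.add_eq, show n + 1 + (s + 1) = (n + (s + 1)) + 1 by omega, Nat.choose_succ_succ',
          show n + 1 + s = n + (s + 1) by omega]
        push_cast
        module
  | add f f' h h' =>
    simp only [map_add, LinearMap.add_apply, smul_add, sum_add_distrib, h, h']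
  | smul t f h =>
    simp only [map_smul, LinearMap.smul_apply, h, smul_sum]
    exact sum_congr rfl fun _ _ => smul_comm _ _ _
  | X_mul f h =>
    simp only [curCoeffₗ_X_mul_left]
    cases m with
    | zero => simp [prev]
    | succ m =>
      rw [sum_range_succ, Nat.sub_self]
      simp only [prev, h, neg_zero, map_zero, LinearMap.zero_apply, smul_zero, add_zero,
        ← sum_neg_distrib]
      refine sum_congr rfl fun s hs => ?_
      rw [show m + 1 - s = (m - s) + 1 by have := mem_range.mp hs; omega]
      simp

section Grading

open TensorProduct

variable {A V : Type*} [AddCommGroup A] [Module ℂ A] [AddCommGroup V] [Module ℂ V]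

@[elab_as_elim]
theorem span_tmul_induction {S : Submodule ℂ V} {P : A ⊗[ℂ] V → Prop} (zero : P 0)
    (add : ∀ x y, P x → P y → P (x + y)) (tmul : ∀ (f : A), ∀ a ∈ S, P (f ⊗ₜ a))
    {x : A ⊗[ℂ] V} (hx : x ∈ Submodule.span ℂ {x : A ⊗[ℂ] V | ∃ f, ∃ a, a ∈ S ∧ x = f ⊗ₜ a}) :
    P x := by
  induction hx using Submodule.closure_induction with
  | zero => exact zero
  | add x y _ _ h h' => exact add x y h h'
  | smul_mem t x h =>
    obtain ⟨f, a, ha, rfl⟩ := h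
    rw [TensorProduct.smul_tmul']
    exact tmul _ a ha

theorem tmul_mem_span {S : Submodule ℂ V} (f : A) {a : V} (ha : a ∈ S) :
    f ⊗ₜ[ℂ] a ∈ Submodule.span ℂ {x : A ⊗[ℂ] V | ∃ f, ∃ a, a ∈ S ∧ x = f ⊗ₜ a} :=
  Submodule.subset_span ⟨f, a, ha, rfl⟩

theorem isInternal_span_tmul {ι : Type*} [DecidableEq ι] {G : ι → Submodule ℂ V}
    (hG : DirectSum.IsInternal G) :
    DirectSum.IsInternal fun i =>
      Submodule.span ℂ {x : A ⊗[ℂ] V | ∃ f, ∃ a, a ∈ G i ∧ x = f ⊗ₜ a} := by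
  refine DirectSum.isInternal_submodule_of_iSupIndep_of_iSup_eq_top (fun i => ?_)
    (Submodule.eq_top_iff'.mpr fun x => ?_)
  · let e : V →ₗ[ℂ] V := (G i).subtype ∘ₗ DirectSum.component ℂ ι (fun i => G i) i ∘ₗ
      (LinearEquiv.ofBijective (DirectSum.coeLinearMap G) hG).symm.toLinearMap
    have e_same : ∀ a ∈ G i, e a = a := fun a ha =>
      congrArg Subtype.val (hG.ofBijective_coeLinearMap_of_mem ha)
    have e_ne : ∀ j, j ≠ i → ∀ a ∈ G j, e a = 0 := fun j hj a ha =>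
      congrArg Subtype.val (hG.ofBijective_coeLinearMap_of_mem_ne hj ha)
    rw [Submodule.disjoint_def]
    intro x hx hx'
    have h1 : e.lTensor A x = x := by
      refine span_tmul_induction (P := fun x => e.lTensor A x = x) (map_zero _) ?_ ?_ hx
      · intro x y h h'
        rw [map_add, h, h']
      · intro f a ha
        rw [LinearMap.lTensor_tmul, e_same a ha]
    have h2 : (⨆ j, ⨆ (_ : j ≠ i),
        Submodule.span ℂ {x : A ⊗[ℂ] V | ∃ f, ∃ a, a ∈ G j ∧ x = f ⊗ₜ a}) ≤
          LinearMap.ker (e.lTensor A) := by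
      refine iSup₂_le fun j hj => Submodule.span_le.mpr ?_
      rintro _ ⟨f, a, ha, rfl⟩
      simp [e_ne j hj a ha]
    rw [← h1]
    exact h2 hx'
  · induction x using TensorProduct.induction_on with
    | zero => exact zero_mem _
    | add x y h h' => exact add_mem h h'
    | tmul f a =>
      have ha : a ∈ ⨆ i, G i := hG.submodule_iSup_eq_top ▸ Submodule.mem_top
      induction ha using Submodule.iSup_induction' with
      | mem i a ha => exact Submodule.mem_iSup_of_mem i (tmul_mem_span f ha)
      | zero => rw [tmul_zero]; exact zero_mem _
      | add a b _ _ h h' => rw [tmul_add]; exact add_mem h h'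

end Grading

end CurrentBracket

open scoped TensorProduct

/-- Let `(g, [·,·], α, β)` be a BiHom-Lie superalgebra. Then the free
ℤ₂-graded `ℂ[∂]`-module `Cur g = ℂ[∂] ⊗ g` (with `(Cur g)_θ = ℂ[∂] ⊗ g_θ`), with the maps
`α(f(∂) ⊗ a) = f(∂) ⊗ α(a)`, `β(f(∂) ⊗ a) = f(∂) ⊗ β(a)` and the λ-bracket
`[(f(∂) ⊗ a)_λ (q(∂) ⊗ b)] = f(−λ) q(∂+λ) ⊗ [a, b]`, is a BiHom-Lie conformal
superalgebra.  (In coefficients of `λⁿ`: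
`f(−λ) q(∂+λ) ⊗ [a,b] = ∑ₙ λⁿ • ∑_{i ≤ n} (−1)^i f_i (q^{(n−i)}/(n−i)!)(∂) ⊗ [a,b]`, where
`q^{(j)}/j!` is the `j`-th Hasse derivative; `br'` is the bilinear map determined by this
formula on pure tensors.) -/
theorem curBiHomLieSuperAlg_isBiHomLieConfSuperAlg {g : Type*} [AddCommGroup g] [Module ℂ g]
    (Gsup : ZMod 2 → Submodule ℂ g) (bkt : g → g → g) (alg beg : Module.End ℂ g)
    (hg : IsBiHomLieSuperAlg Gsup bkt alg beg)
    (br' : ℕ → Polynomial ℂ ⊗[ℂ] g → Polynomial ℂ ⊗[ℂ] g → Polynomial ℂ ⊗[ℂ] g)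
    (hbil : IsBil br')
    (hbr' : ∀ (f q : Polynomial ℂ) (a b : g) (n : ℕ),
      br' n (f ⊗ₜ a) (q ⊗ₜ b) =
        ∑ i ∈ Finset.range (n + 1),
          ((-1 : ℂ) ^ i * f.coeff i) • ((Polynomial.hasseDeriv (n - i) q) ⊗ₜ bkt a b)) :
    IsBiHomLieConfSuperAlg
      (fun θ => Submodule.span ℂ
        {x : Polynomial ℂ ⊗[ℂ] g | ∃ (f : Polynomial ℂ) (a : g), a ∈ Gsup θ ∧ x = f ⊗ₜ a})
      ((LinearMap.mulLeft ℂ (Polynomial.X : Polynomial ℂ)).rTensor g)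
      (alg.lTensor (Polynomial ℂ)) (beg.lTensor (Polynomial ℂ)) br' := by
  obtain ⟨B, rfl⟩ : ∃ B : ℕ → Polynomial ℂ ⊗[ℂ] g →ₗ[ℂ] Polynomial ℂ ⊗[ℂ] g →ₗ[ℂ]
      Polynomial ℂ ⊗[ℂ] g, br' = fun n x y => B n x y :=
    ⟨fun n => LinearMap.mk₂ ℂ (br' n) (hbil.add_left n) (hbil.smul_left n) (hbil.add_right n)
      fun t x y => hbil.smul_right n t x y, rfl⟩
  have hB : ∀ (n : ℕ) (f q : Polynomial ℂ) (a b : g),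
      B n (f ⊗ₜ a) (q ⊗ₜ b) = curCoeffₗ n f q ⊗ₜ bkt a b := by
    intro n f q a b
    rw [curCoeffₗ_apply, curCoeff, TensorProduct.sum_tmul]
    refine (hbr' f q a b n).trans ?_
    simp only [TensorProduct.smul_tmul']
  clear hbr'
  have locality : ∀ x y, ∃ N, ∀ n ≥ N, B n x y = 0 := by
    intro x y
    induction x using TensorProduct.induction_on with
    | zero => exact ⟨0, fun n _ => by rw [map_zero, LinearMap.zero_apply]⟩
    | add x x' h h' =>
      obtain ⟨N, hN⟩ := h
      obtain ⟨K, hK⟩ := h'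
      exact ⟨max N K, fun n hn => by
        rw [map_add, LinearMap.add_apply, hN n (le_of_max_le_left hn),
          hK n (le_of_max_le_right hn), add_zero]⟩
    | tmul f a =>
      induction y using TensorProduct.induction_on with
      | zero => exact ⟨0, fun n _ => map_zero _⟩
      | add y y' h h' =>
        obtain ⟨N, hN⟩ := h
        obtain ⟨K, hK⟩ := h'
        exact ⟨max N K, fun n hn => by
          rw [map_add, hN n (le_of_max_le_left hn), hK n (le_of_max_le_right hn), add_zero]⟩
      | tmul q b =>
        obtain ⟨N, hN⟩ := curCoeffₗ_eventually_zero f q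
        exact ⟨N, fun n hn => by rw [hB, hN n hn, TensorProduct.zero_tmul]⟩
  have map_br : ∀ φ : Module.End ℂ g, (∀ a b, φ (bkt a b) = bkt (φ a) (φ b)) →
      ∀ n x y, φ.lTensor (Polynomial ℂ) (B n x y) =
        B n (φ.lTensor (Polynomial ℂ) x) (φ.lTensor (Polynomial ℂ) y) := by
    intro φ hφ n x y
    induction x using TensorProduct.induction_on with
    | zero => simp
    | add x x' h h' => simp only [map_add, LinearMap.add_apply, h, h']
    | tmul f a =>
      induction y using TensorProduct.induction_on with
      | zero => simp
      | add y y' h h' => simp only [map_add, h, h']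
      | tmul q b => simp only [hB, LinearMap.lTensor_tmul, hφ]
  have lTensor_even : ∀ φ : Module.End ℂ g, (∀ i, ∀ a ∈ Gsup i, φ a ∈ Gsup i) → ∀ i,
      ∀ x ∈ Submodule.span ℂ
        {x : Polynomial ℂ ⊗[ℂ] g | ∃ (f : Polynomial ℂ) (a : g), a ∈ Gsup i ∧ x = f ⊗ₜ a},
      φ.lTensor (Polynomial ℂ) x ∈ Submodule.span ℂ
        {x : Polynomial ℂ ⊗[ℂ] g | ∃ (f : Polynomial ℂ) (a : g), a ∈ Gsup i ∧ x = f ⊗ₜ a} := by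
    intro φ hφ i x hx
    refine span_tmul_induction ?_ ?_ ?_ hx
    · rw [map_zero]; exact zero_mem _
    · intro x y h h'; rw [map_add]; exact add_mem h h'
    · intro f a ha
      exact tmul_mem_span f (hφ i a ha)
  have lTensor_der : ∀ (φ : Module.End ℂ g) x,
      φ.lTensor (Polynomial ℂ) ((LinearMap.mulLeft ℂ (Polynomial.X : Polynomial ℂ)).rTensor g x) =
        (LinearMap.mulLeft ℂ (Polynomial.X : Polynomial ℂ)).rTensor g
          (φ.lTensor (Polynomial ℂ) x) := by
    intro φ x
    rw [← LinearMap.comp_apply, ← LinearMap.comp_apply, LinearMap.lTensor_comp_rTensor,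
      LinearMap.rTensor_comp_lTensor]
  refine
    { internal := isInternal_span_tmul hg.internal
      der_even := fun i x hx => ?_
      al_even := lTensor_even alg hg.al_even
      be_even := lTensor_even beg hg.be_even
      al_be_comm := fun x => ?_
      al_der := lTensor_der alg
      be_der := lTensor_der beg
      bil := hbil
      grade := fun i j n x y hx hy => ?_
      locality := locality
      al_br := map_br alg hg.al_bkt
      be_br := map_br beg hg.be_bkt
      sesq₁ := fun n x y => ?_
      sesq₂ := fun n x y => ?_
      skew := fun i j n x y hx hy => ?_
      jacobi := fun i j m n x y z hx hy => ?_ }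
  · refine span_tmul_induction ?_ ?_ ?_ hx
    · rw [map_zero]; exact zero_mem _
    · intro x y h h'; rw [map_add]; exact add_mem h h'
    · intro f a ha
      exact tmul_mem_span _ ha
  · rw [← LinearMap.comp_apply, ← LinearMap.comp_apply, ← LinearMap.lTensor_comp,
      ← LinearMap.lTensor_comp, show alg ∘ₗ beg = beg ∘ₗ alg from LinearMap.ext hg.al_be_comm]
  · refine span_tmul_induction ?_ ?_ ?_ hx
    · rw [map_zero]; exact zero_mem _
    · intro x y h h'; rw [map_add]; exact add_mem h h'
    · intro f a ha
      refine span_tmul_induction ?_ ?_ ?_ hy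
      · rw [map_zero]; exact zero_mem _
      · intro x y h h'; rw [map_add]; exact add_mem h h'
      · intro q b hb
        rw [hB]
        exact tmul_mem_span _ (hg.grade i j a b ha hb)
  · induction x using TensorProduct.induction_on with
    | zero => cases n <;> simp [prev]
    | add x x' h h' =>
      simp only [map_add, LinearMap.add_apply, h, h']
      cases n <;> simp [prev, add_comm]
    | tmul f a =>
      induction y using TensorProduct.induction_on with
      | zero => cases n <;> simp [prev]
      | add y y' h h' =>
        simp only [map_add, h, h']
        cases n <;> simp [prev, add_comm]
      | tmul q b =>
        simp only [LinearMap.rTensor_tmul, LinearMap.mulLeft_apply, hB, curCoeffₗ_X_mul_left,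
          TensorProduct.neg_tmul]
        cases n <;> simp [prev]
  · induction x using TensorProduct.induction_on with
    | zero => cases n <;> simp [prev]
    | add x x' h h' =>
      simp only [map_add, LinearMap.add_apply, h, h']
      cases n <;> simp only [prev] <;> abel
    | tmul f a =>
      induction y using TensorProduct.induction_on with
      | zero => cases n <;> simp [prev]
      | add y y' h h' =>
        simp only [map_add, h, h']
        cases n <;> simp only [prev] <;> abel
      | tmul q b =>
        simp only [LinearMap.rTensor_tmul, LinearMap.mulLeft_apply, hB, curCoeffₗ_X_mul_right,
          TensorProduct.add_tmul]
        cases n <;> simp [prev]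
  · have nsub_zero : nsub ((LinearMap.mulLeft ℂ (Polynomial.X : Polynomial ℂ)).rTensor g)
        (fun _ => 0) n = 0 := by simp [nsub]
    refine span_tmul_induction ?_ ?_ ?_ hx
    · simp [nsub_zero]
    · intro x x' h h'
      simp only [map_add, LinearMap.add_apply] at h h' ⊢
      rw [nsub_add _ (locality _ _) (locality _ _), h, h', smul_add]
    · intro f a ha
      refine span_tmul_induction ?_ ?_ ?_ hy
      · simp [nsub_zero]
      · intro y y' h h'
        simp only [map_add, LinearMap.add_apply] at h h' ⊢
        rw [nsub_add _ (locality _ _) (locality _ _), h, h', smul_add]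
      · intro q b hb
        simp only [LinearMap.lTensor_tmul, hB]
        rw [hg.skew i j a b ha hb, TensorProduct.tmul_smul, curCoeffₗ_skew f q n]
        congr 1
        exact (nsub_map ((TensorProduct.mk ℂ (Polynomial ℂ) g).flip (bkt (beg b) (alg a)))
          (fun _ => rfl) (curCoeffₗ_eventually_zero q f) n).symm
  · refine span_tmul_induction ?_ ?_ ?_ hx
    · simp
    · intro x x' h h'
      simp only [map_add, LinearMap.add_apply, smul_add, sum_add_distrib] at h h' ⊢
      rw [h, h']
      abel
    · intro f a ha
      refine span_tmul_induction ?_ ?_ ?_ hy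
      · simp
      · intro y y' h h'
        simp only [map_add, LinearMap.add_apply, smul_add, sum_add_distrib] at h h' ⊢
        rw [h, h']
        abel
      · intro q b hb
        induction z using TensorProduct.induction_on with
        | zero => simp
        | add z z' h h' =>
          simp only [map_add, smul_add, sum_add_distrib] at h h' ⊢
          rw [h, h']
          abel
        | tmul r c =>
          simp only [LinearMap.lTensor_tmul, hB, TensorProduct.smul_tmul',
            ← TensorProduct.sum_tmul]
          rw [← curCoeffₗ_assoc, hg.jacobi i j a b c ha hb, TensorProduct.tmul_add,
            TensorProduct.tmul_smul, curCoeffₗ_left_comm q f r n m, TensorProduct.smul_tmul']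
end
end

section
/- Let (R, [·_λ·], α, β) be a BiHom-Lie conformal superalgebra and let α′, β′ : R → R be two even maps commuting with ∂ and preserving the λ-bracket (α′([a_λ b]) = [α′(a)_λ α′(b)] and likewise for β′), such that any two of the maps α, β, α′, β′ commute. Then (R, [·_λ·]′, α∘α′, β∘β′), where [a_λ b]′ = [α′(a)_λ β′(b)], is a BiHom-Lie conformal superalgebra. -/
/- ## Conventions

A (ℤ₂-graded) `ℂ[∂]`-module is a complex vector space `R` together with
`D : Module.End ℂ R` (the action of `∂`) and a grading `G : ZMod 2 → Submodule ℂ R`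
which is an internal direct sum decomposition.

A `λ`-bracket `R ⊗ R → ℂ[λ] ⊗ R` is encoded by its coefficients:
`br : ℕ → R → R → R`, where `[a_λ b] = ∑ₙ λⁿ • br n a b` (a finite sum, by the
`locality` axiom which expresses that the values really lie in `ℂ[λ] ⊗ R`).
All axioms of the various kinds of conformal superalgebras are expressed below by
comparing coefficients of the polynomial identities in `λ` (and `μ`). -/

noncomputable section

open Finset

/-- Let `(R, [·_λ·], α, β)` be a BiHom-Lie conformal superalgebra and
`α′, β′ : R → R` two even maps commuting with `∂` and preserving the λ-bracket, such that
any two of `α, β, α′, β′` commute. Then `(R, [·_λ·]′, α∘α′, β∘β′)`, where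
`[a_λ b]′ = [α′(a)_λ β′(b)]`, is a BiHom-Lie conformal superalgebra. -/
theorem biHomLieConfSuperAlg_twist {R : Type*} [AddCommGroup R] [Module ℂ R]
    (G : ZMod 2 → Submodule ℂ R) (D : Module.End ℂ R) (al be : Module.End ℂ R)
    (br : ℕ → R → R → R)
    (hR : IsBiHomLieConfSuperAlg G D al be br)
    (al' be' : Module.End ℂ R)
    (hal'_even : ∀ (i : ZMod 2) (a : R), a ∈ G i → al' a ∈ G i)
    (hbe'_even : ∀ (i : ZMod 2) (a : R), a ∈ G i → be' a ∈ G i)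
    (hal'_der : ∀ a, al' (D a) = D (al' a))
    (hbe'_der : ∀ a, be' (D a) = D (be' a))
    (hal'_br : ∀ (n : ℕ) (a b : R), al' (br n a b) = br n (al' a) (al' b))
    (hbe'_br : ∀ (n : ℕ) (a b : R), be' (br n a b) = br n (be' a) (be' b))
    (hc₁ : ∀ a, al (al' a) = al' (al a))
    (hc₂ : ∀ a, al (be' a) = be' (al a))
    (hc₃ : ∀ a, be (al' a) = al' (be a))
    (hc₄ : ∀ a, be (be' a) = be' (be a))
    (hc₅ : ∀ a, al' (be' a) = be' (al' a)) :
    IsBiHomLieConfSuperAlg G D (al ∘ₗ al') (be ∘ₗ be')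
      (fun n a b => br n (al' a) (be' b)) := by
  have hc₆ := hR.al_be_comm
  refine
    { internal := hR.internal
      der_even := hR.der_even
      al_even := fun i a ha => hR.al_even i _ (hal'_even i a ha)
      be_even := fun i a ha => hR.be_even i _ (hbe'_even i a ha)
      al_be_comm := fun a => by simp [hc₁, hc₂, hc₃, hc₄, hc₅, hc₆]
      al_der := fun a => by simp [hal'_der, hR.al_der]
      be_der := fun a => by simp [hbe'_der, hR.be_der]
      bil := ⟨fun n a b v => ?_, fun n t a v => ?_, fun n a v w => ?_, fun n t a v => ?_⟩
      grade := fun i j n a b ha hb => hR.grade i j n _ _ (hal'_even i a ha) (hbe'_even j b hb)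
      locality := fun a b => hR.locality _ _
      al_br := fun n a b => by simp [hal'_br, hR.al_br, hc₁, hc₂, hc₅]
      be_br := fun n a b => by simp [hbe'_br, hR.be_br, hc₃, hc₄, hc₅]
      sesq₁ := fun n a b => by simpa [hal'_der] using hR.sesq₁ n (al' a) (be' b)
      sesq₂ := fun n a b => by simpa [hbe'_der] using hR.sesq₂ n (al' a) (be' b)
      skew := fun i j n a b ha hb => ?_
      jacobi := fun i j m n a b c ha hb => ?_ }
  · simp [hR.bil.add_left]
  · simp [hR.bil.smul_left]
  · simp [hR.bil.add_right]
  · simp [hR.bil.smul_right]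
  · have h := hR.skew i j n (al' (be' a)) (al' (be' b))
      (hal'_even i _ (hbe'_even i a ha)) (hal'_even j _ (hbe'_even j b hb))
    simpa only [LinearMap.comp_apply, hc₁, hc₂, hc₃, hc₄, hc₅] using h
  · have h := hR.jacobi i j m n (al' (al' (be' a))) (al' (be' b)) (be' (be' c))
      (hal'_even i _ (hal'_even i _ (hbe'_even i a ha))) (hal'_even j _ (hbe'_even j b hb))
    simpa only [LinearMap.comp_apply, hal'_br, hbe'_br, hc₁, hc₂, hc₃, hc₄, hc₅, hc₆] using h
end
end

section
/- Let (R, [·_λ·], α, β) be a BiHom-Lie conformal superalgebra and k ∈ ℤ_{≥0}. Then (R, [·_λ·]′, α^{k+1}, β^{k+1}), where [a_λ b]′ = [α^k(a)_λ β^k(b)], is a BiHom-Lie conformal superalgebra. -/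
/- ## Conventions

A (ℤ₂-graded) `ℂ[∂]`-module is a complex vector space `R` together with
`D : Module.End ℂ R` (the action of `∂`) and a grading `G : ZMod 2 → Submodule ℂ R`
which is an internal direct sum decomposition.

A `λ`-bracket `R ⊗ R → ℂ[λ] ⊗ R` is encoded by its coefficients:
`br : ℕ → R → R → R`, where `[a_λ b] = ∑ₙ λⁿ • br n a b` (a finite sum, by the
`locality` axiom which expresses that the values really lie in `ℂ[λ] ⊗ R`).
All axioms of the various kinds of conformal superalgebras are expressed below by
comparing coefficients of the polynomial identities in `λ` (and `μ`). -/

noncomputable section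

open Finset

/-- A submodule stable under `f` is stable under the powers of `f`. -/
theorem Submodule.end_pow_apply_mem {R : Type*} [AddCommGroup R] [Module ℂ R]
    {p : Submodule ℂ R} {f : Module.End ℂ R} (hf : ∀ a ∈ p, f a ∈ p) (k : ℕ) {a : R}
    (ha : a ∈ p) : (f ^ k) a ∈ p := by
  induction k with
  | zero => simpa using ha
  | succ k ih => simpa only [pow_succ', Module.End.mul_apply] using hf _ ih

/-- Powers of an endomorphism preserving a `λ`-bracket preserve it. -/
theorem Module.End.pow_apply_bracket {R : Type*} [AddCommGroup R] [Module ℂ R]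
    {f : Module.End ℂ R} {br : ℕ → R → R → R}
    (hf : ∀ (n : ℕ) (a b : R), f (br n a b) = br n (f a) (f b)) (k n : ℕ) (a b : R) :
    (f ^ k) (br n a b) = br n ((f ^ k) a) ((f ^ k) b) := by
  induction k with
  | zero => simp
  | succ k ih => simp only [pow_succ', Module.End.mul_apply, ih, hf]

/-- Let `(R, [·_λ·], α, β)` be a BiHom-Lie conformal superalgebra and
`k ∈ ℤ_{≥0}`. Then `(R, [·_λ·]′, α^{k+1}, β^{k+1})`, where `[a_λ b]′ = [α^k(a)_λ β^k(b)]`,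
is a BiHom-Lie conformal superalgebra. -/
theorem biHomLieConfSuperAlg_pow_twist {R : Type*} [AddCommGroup R] [Module ℂ R]
    (G : ZMod 2 → Submodule ℂ R) (D : Module.End ℂ R) (al be : Module.End ℂ R)
    (br : ℕ → R → R → R)
    (hR : IsBiHomLieConfSuperAlg G D al be br) (k : ℕ) :
    IsBiHomLieConfSuperAlg G D (al ^ (k + 1)) (be ^ (k + 1))
      (fun n a b => br n ((al ^ k) a) ((be ^ k) b)) := by
  have comm : Commute al be := LinearMap.ext hR.al_be_comm
  have al_D : Commute al D := LinearMap.ext hR.al_der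
  have be_D : Commute be D := LinearMap.ext hR.be_der
  have be_al (m n : ℕ) (x : R) : (be ^ m) ((al ^ n) x) = (al ^ n) ((be ^ m) x) :=
    (LinearMap.congr_fun (comm.pow_pow n m).eq x).symm
  have al_pow_D (n : ℕ) (x : R) : (al ^ n) (D x) = D ((al ^ n) x) :=
    LinearMap.congr_fun (al_D.pow_left n).eq x
  have be_pow_D (n : ℕ) (x : R) : (be ^ n) (D x) = D ((be ^ n) x) :=
    LinearMap.congr_fun (be_D.pow_left n).eq x
  have al_br := Module.End.pow_apply_bracket hR.al_br
  have be_br := Module.End.pow_apply_bracket hR.be_br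
  have al_mem (i : ZMod 2) (n : ℕ) {a : R} (ha : a ∈ G i) : (al ^ n) a ∈ G i :=
    Submodule.end_pow_apply_mem (hR.al_even i) n ha
  have be_mem (i : ZMod 2) (n : ℕ) {a : R} (ha : a ∈ G i) : (be ^ n) a ∈ G i :=
    Submodule.end_pow_apply_mem (hR.be_even i) n ha
  have al_al (m n : ℕ) (x : R) : (al ^ m) ((al ^ n) x) = (al ^ (m + n)) x := by
    rw [pow_add, Module.End.mul_apply]
  have be_be (m n : ℕ) (x : R) : (be ^ m) ((be ^ n) x) = (be ^ (m + n)) x := by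
    rw [pow_add, Module.End.mul_apply]
  have skew := hR.skew
  have jacobi := hR.jacobi
  rw [← pow_one al, ← pow_one be] at skew jacobi
  refine
    { internal := hR.internal
      der_even := hR.der_even
      al_even := fun i _ ha => al_mem i _ ha
      be_even := fun i _ ha => be_mem i _ ha
      al_be_comm := fun a => (be_al _ _ a).symm
      al_der := al_pow_D _
      be_der := be_pow_D _
      bil := ?_
      grade := fun i j n a b ha hb => hR.grade i j n _ _ (al_mem i k ha) (be_mem j k hb)
      locality := fun a b => hR.locality _ _
      al_br := fun n a b => ?_
      be_br := fun n a b => ?_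
      sesq₁ := fun n a b => ?_
      sesq₂ := fun n a b => ?_
      skew := fun i j n a b ha hb => ?_
      jacobi := fun i j m n a b c ha hb => ?_ }
  · constructor <;> intros <;>
      simp only [map_add, map_smul, hR.bil.add_left, hR.bil.add_right, hR.bil.smul_left,
        hR.bil.smul_right]
  · simp only [al_br, be_al, al_al, add_comm]
  · simp only [be_br, be_al, be_be, add_comm]
  · simp only [al_pow_D, hR.sesq₁]
  · simp only [be_pow_D, hR.sesq₂]
  · have h := skew i j n _ _ (al_mem i k (be_mem i k ha)) (al_mem j k (be_mem j k hb))
    simp only [be_al, al_al, be_be, add_comm 1 k] at h ⊢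
    exact h
  · have h := jacobi i j m n _ _ ((be ^ (k + k)) c)
      (al_mem i (k + k) (be_mem i k ha)) (al_mem j k (be_mem j k hb))
    simp only [al_br, be_br, be_al, al_al, be_be] at h ⊢
    ring_nf at h ⊢
    exact h
end
end

section
/- Let (R, [·_λ·], α, β) be a regular BiHom-Lie conformal superalgebra, k, l ∈ ℤ with l ≥ 0 such that β^{l−1} is defined (β invertible), and let a ∈ R be a homogeneous element with α(a) = a and β(a) = a. Then the map f_{k,l}(a) defined by f_{k,l}(a)_λ(b) = [a_λ α^{k+1}β^{l−1}(b)] is an α^{k+1}β^l-derivation of R; that is, f_{k,l}(a)_λ(∂b) = (∂+λ) f_{k,l}(a)_λ(b), f_{k,l}(a)_λ ∘ α = α ∘ f_{k,l}(a)_λ, f_{k,l}(a)_λ ∘ β = β ∘ f_{k,l}(a)_λ, and f_{k,l}(a)_λ([b_μ c]) = [f_{k,l}(a)_λ(b)_{λ+μ} α^{k+1}β^l(c)] + (−1)^{|a||b|}[α^{k+1}β^l(b)_μ f_{k,l}(a)_λ(c)] for homogeneous b, c ∈ R. -/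
/- ## Conventions

A (ℤ₂-graded) `ℂ[∂]`-module is a complex vector space `R` together with
`D : Module.End ℂ R` (the action of `∂`) and a grading `G : ZMod 2 → Submodule ℂ R`
which is an internal direct sum decomposition.

A `λ`-bracket `R ⊗ R → ℂ[λ] ⊗ R` is encoded by its coefficients:
`br : ℕ → R → R → R`, where `[a_λ b] = ∑ₙ λⁿ • br n a b` (a finite sum, by the
`locality` axiom which expresses that the values really lie in `ℂ[λ] ⊗ R`).
All axioms of the various kinds of conformal superalgebras are expressed below by
comparing coefficients of the polynomial identities in `λ` (and `μ`). -/

noncomputable section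

open Finset

section Derivations

variable {R : Type*} [AddCommGroup R] [Module ℂ R]

/-- Membership in `Ω`: `f` lists the coefficients of a conformal linear map
`f_λ = ∑ₙ λⁿ fₙ : R → R[λ]` of parity `θ` (so `f_λ(∂a) = (∂+λ) f_λ(a)` and
`f_λ(R_i) ⊆ R_{i+θ}[λ]`) which commutes with `α` and `β`. -/
structure InOmega (G : ZMod 2 → Submodule ℂ R) (D al be : Module.End ℂ R)
    (θ : ZMod 2) (f : ℕ → R → R) : Prop where
  add : ∀ (n : ℕ) (a b : R), f n (a + b) = f n a + f n b
  smul : ∀ (n : ℕ) (t : ℂ) (a : R), f n (t • a) = t • f n a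
  locality : ∃ N, ∀ n ≥ N, ∀ a, f n a = 0
  conf : ∀ (n : ℕ) (a : R), f n (D a) = D (f n a) + prev (fun m => f m a) n
  comm_al : ∀ (n : ℕ) (a : R), f n (al a) = al (f n a)
  comm_be : ∀ (n : ℕ) (a : R), f n (be a) = be (f n a)
  grade : ∀ (i : ZMod 2) (n : ℕ) (a : R), a ∈ G i → f n a ∈ G (i + θ)

/-- The coefficient identity (in `λ^m μ^n`) of the generalized-derivation equation
`[f_λ(a)_{λ+μ} W(b)] + (−1)^{|f||a|} [W(a)_μ f′_λ(b)] = f″_λ([a_μ b])`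
for homogeneous `a, b`, where `W` is the twisting map (e.g. `α^k β^l`). -/
def LeibnizTriple (G : ZMod 2 → Submodule ℂ R) (br : ℕ → R → R → R)
    (W : Module.End ℂ R) (θ : ZMod 2) (f f' f'' : ℕ → R → R) : Prop :=
  ∀ (i j : ZMod 2) (m n : ℕ) (a b : R), a ∈ G i → b ∈ G j →
    (∑ s ∈ Finset.range (m + 1), (((n + s).choose s : ℂ)) • br (n + s) (f (m - s) a) (W b))
      + sgn θ i • br n (W a) (f' m b) = f'' m (br n a b)

/-- `f` is a (homogeneous, of parity `θ`) `W`-derivation (`W = α^k β^l`):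
`f_λ([a_μ b]) = [f_λ(a)_{λ+μ} W(b)] + (−1)^{|a||f|} [W(a)_μ f_λ(b)]`. -/
def IsDerivation (G : ZMod 2 → Submodule ℂ R) (D al be : Module.End ℂ R)
    (br : ℕ → R → R → R) (W : Module.End ℂ R) (θ : ZMod 2) (f : ℕ → R → R) : Prop :=
  InOmega G D al be θ f ∧ LeibnizTriple G br W θ f f f

/-- `f` is a (homogeneous, of parity `θ`) generalized `W`-derivation: there are
`f′, f″ ∈ Ω` of the same parity with
`[f_λ(a)_{λ+μ} W(b)] + (−1)^{|f||a|} [W(a)_μ f′_λ(b)] = f″_λ([a_μ b])`. -/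
def IsGenDerivation (G : ZMod 2 → Submodule ℂ R) (D al be : Module.End ℂ R)
    (br : ℕ → R → R → R) (W : Module.End ℂ R) (θ : ZMod 2) (f : ℕ → R → R) : Prop :=
  InOmega G D al be θ f ∧ ∃ f' f'' : ℕ → R → R,
    InOmega G D al be θ f' ∧ InOmega G D al be θ f'' ∧ LeibnizTriple G br W θ f f' f''

/-- `f` is a (homogeneous, of parity `θ`) `W`-quasiderivation: there is `f′ ∈ Ω` of the
same parity with `[f_λ(a)_{λ+μ} W(b)] + (−1)^{|f||a|} [W(a)_μ f_λ(b)] = f′_λ([a_μ b])`. -/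
def IsQuasiDerivation (G : ZMod 2 → Submodule ℂ R) (D al be : Module.End ℂ R)
    (br : ℕ → R → R → R) (W : Module.End ℂ R) (θ : ZMod 2) (f : ℕ → R → R) : Prop :=
  InOmega G D al be θ f ∧ ∃ f' : ℕ → R → R,
    InOmega G D al be θ f' ∧ LeibnizTriple G br W θ f f f'

/-- The coefficient identity of the quasicentroid equation
`[f_λ(a)_{λ+μ} W(b)] = (−1)^{|f||a|} [W(a)_μ f_λ(b)]` for homogeneous `a, b`. -/
def QCentProp (G : ZMod 2 → Submodule ℂ R) (br : ℕ → R → R → R)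
    (W : Module.End ℂ R) (θ : ZMod 2) (f : ℕ → R → R) : Prop :=
  ∀ (i j : ZMod 2) (m n : ℕ) (a b : R), a ∈ G i → b ∈ G j →
    (∑ s ∈ Finset.range (m + 1), (((n + s).choose s : ℂ)) • br (n + s) (f (m - s) a) (W b))
      = sgn θ i • br n (W a) (f m b)

/-- `f` is a (homogeneous, of parity `θ`) `W`-quasicentroid. -/
def IsQuasiCentroid (G : ZMod 2 → Submodule ℂ R) (D al be : Module.End ℂ R)
    (br : ℕ → R → R → R) (W : Module.End ℂ R) (θ : ZMod 2) (f : ℕ → R → R) : Prop :=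
  InOmega G D al be θ f ∧ QCentProp G br W θ f

/-- `f` is a (homogeneous, of parity `θ`) `W`-centroid:
`[f_λ(a)_{λ+μ} W(b)] = (−1)^{|f||a|} [W(a)_μ f_λ(b)] = f_λ([a_μ b])`. -/
def IsCentroid (G : ZMod 2 → Submodule ℂ R) (D al be : Module.End ℂ R)
    (br : ℕ → R → R → R) (W : Module.End ℂ R) (θ : ZMod 2) (f : ℕ → R → R) : Prop :=
  InOmega G D al be θ f ∧ QCentProp G br W θ f ∧
    ∀ (i j : ZMod 2) (m n : ℕ) (a b : R), a ∈ G i → b ∈ G j →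
      (∑ s ∈ Finset.range (m + 1),
        (((n + s).choose s : ℂ)) • br (n + s) (f (m - s) a) (W b)) = f m (br n a b)

/-- `f` is a (homogeneous, of parity `θ`) central `W`-derivation:
`[f_λ(a)_{λ+μ} W(b)] = f_λ([a_μ b]) = 0` for homogeneous `a, b`. -/
def IsCentralDerivation (G : ZMod 2 → Submodule ℂ R) (D al be : Module.End ℂ R)
    (br : ℕ → R → R → R) (W : Module.End ℂ R) (θ : ZMod 2) (f : ℕ → R → R) : Prop :=
  InOmega G D al be θ f ∧
    (∀ (i j : ZMod 2) (m n : ℕ) (a b : R), a ∈ G i → b ∈ G j →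
      (∑ s ∈ Finset.range (m + 1),
        (((n + s).choose s : ℂ)) • br (n + s) (f (m - s) a) (W b)) = 0) ∧
    (∀ (i j : ZMod 2) (m n : ℕ) (a b : R), a ∈ G i → b ∈ G j → f m (br n a b) = 0)

/-- The coefficient of `λ^q μ^m` (applied to `a`) of the commutator
`[f_λ g]_μ (a) = f_λ(g_{μ−λ}(a)) − (−1)^{|f||g|} g_{μ−λ}(f_λ(a))`
of two conformal linear maps of parities `θf`, `θg`. -/
def confComm (f g : ℕ → R → R) (θf θg : ZMod 2) (q m : ℕ) (a : R) : R :=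
  ∑ t ∈ Finset.range (q + 1),
    ((-1 : ℂ) ^ t * ((m + t).choose m : ℂ)) •
      (f (q - t) (g (m + t) a) - sgn θf θg • g (m + t) (f (q - t) a))

end Derivations

/-- The group of automorphisms of a graded `ℂ[∂]`-module with `λ`-bracket: the linear
automorphisms which preserve the grading and the bracket and commute with `∂`. -/
def bracketAut {R : Type*} [AddCommGroup R] [Module ℂ R] (G : ZMod 2 → Submodule ℂ R)
    (D : Module.End ℂ R) (br : ℕ → R → R → R) : Subgroup (R ≃ₗ[ℂ] R) where
  carrier := {f | (∀ i x, f x ∈ G i ↔ x ∈ G i) ∧ (∀ x, f (D x) = D (f x)) ∧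
    ∀ n x y, f (br n x y) = br n (f x) (f y)}
  mul_mem' {f g} hf hg :=
    ⟨fun i x => (hf.1 i (g x)).trans (hg.1 i x),
      fun x => by simp [hf.2.1, hg.2.1], fun n x y => by simp [hf.2.2, hg.2.2]⟩
  one_mem' := ⟨fun _ _ => Iff.rfl, fun _ => rfl, fun _ _ _ => rfl⟩
  inv_mem' {f} hf := by
    have key : ∀ x, f (f⁻¹ x) = x := f.apply_symm_apply
    refine ⟨fun i x => ?_, fun x => f.injective ?_, fun n x y => f.injective ?_⟩
    · rw [← hf.1, key]
    · rw [hf.2.1, key, key]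
    · rw [hf.2.2, key, key, key]

/-- A linear automorphism which maps each component of a `ℤ₂`-grading into itself
also reflects membership in the components. -/
theorem mem_graded_iff_of_even {R : Type*} [AddCommGroup R] [Module ℂ R]
    {G : ZMod 2 → Submodule ℂ R} (hG : DirectSum.IsInternal G) (f : R ≃ₗ[ℂ] R)
    (hf : ∀ i x, x ∈ G i → f x ∈ G i) (i : ZMod 2) (x : R) : f x ∈ G i ↔ x ∈ G i := by
  refine ⟨fun hx => ?_, hf i x⟩
  have huniv : ∀ i j : ZMod 2, j = i ∨ j = i + 1 := by decide
  have hc : IsCompl (G i) (G (i + 1)) :=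
    (DirectSum.isInternal_submodule_iff_isCompl G (by simp)
      (Set.ext fun j => by simpa using huniv i j)).1 hG
  obtain ⟨u, hu, v, hv, rfl⟩ := Submodule.mem_sup.1
    (hc.sup_eq_top ▸ Submodule.mem_top : x ∈ G i ⊔ G (i + 1))
  have hfv : f v ∈ G i := by
    simpa using (G i).sub_mem hx (hf i u hu)
  have hv0 : f v = 0 := Submodule.disjoint_def.1 hc.disjoint _ hfv (hf _ v hv)
  rw [(map_eq_zero_iff f f.injective).1 hv0, add_zero]
  exact hu

/-- Let `(R, [·_λ·], α, β)` be a regular BiHom-Lie conformal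
superalgebra (`α, β` invertible), `k, l ∈ ℤ` with `l ≥ 0`, and let `a ∈ R` be a
homogeneous element with `α(a) = a` and `β(a) = a`. Then the map `f_{k,l}(a)` defined by
`f_{k,l}(a)_λ(b) = [a_λ α^{k+1}β^{l−1}(b)]` is an `α^{k+1}β^l`-derivation of `R`; that is
(writing `F q b` for the coefficient of `λ^q` in `f_{k,l}(a)_λ(b)`):
`f_{k,l}(a)_λ(∂b) = (∂+λ) f_{k,l}(a)_λ(b)`, `f_{k,l}(a)_λ ∘ α = α ∘ f_{k,l}(a)_λ`,
`f_{k,l}(a)_λ ∘ β = β ∘ f_{k,l}(a)_λ`, and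
`f_{k,l}(a)_λ([b_μ c]) = [f_{k,l}(a)_λ(b)_{λ+μ} α^{k+1}β^l(c)] + (−1)^{|a||b|}[α^{k+1}β^l(b)_μ f_{k,l}(a)_λ(c)]`
for homogeneous `b, c ∈ R` (written out in coefficients of `λ^m μ^n`). -/
theorem innerDerivation_isDerivation {R : Type*} [AddCommGroup R] [Module ℂ R]
    (G : ZMod 2 → Submodule ℂ R) (D : Module.End ℂ R) (al be : R ≃ₗ[ℂ] R)
    (br : ℕ → R → R → R)
    (hR : IsBiHomLieConfSuperAlg G D al.toLinearMap be.toLinearMap br)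
    (k l : ℤ) (hl : 0 ≤ l)
    (i₀ : ZMod 2) (a : R) (ha : a ∈ G i₀) (haα : al a = a) (haβ : be a = a)
    (F : ℕ → R → R)
    (hF : ∀ (q : ℕ) (b : R), F q b = br q a ((al ^ (k + 1) * be ^ (l - 1) : R ≃ₗ[ℂ] R) b)) :
    (∀ (n : ℕ) (b : R), F n (D b) = D (F n b) + prev (fun m => F m b) n) ∧
    (∀ (n : ℕ) (b : R), F n (al b) = al (F n b)) ∧
    (∀ (n : ℕ) (b : R), F n (be b) = be (F n b)) ∧
    (∀ (j j' : ZMod 2) (m n : ℕ) (b c : R), b ∈ G j → c ∈ G j' →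
      F m (br n b c) =
        (∑ s ∈ Finset.range (m + 1),
          (((n + s).choose s : ℂ)) •
            br (n + s) (F (m - s) b) ((al ^ (k + 1) * be ^ l : R ≃ₗ[ℂ] R) c))
        + sgn i₀ j • br n ((al ^ (k + 1) * be ^ l : R ≃ₗ[ℂ] R) b) (F m c)) := by
  have hal : al ∈ bracketAut G D br :=
    ⟨mem_graded_iff_of_even hR.internal al hR.al_even, hR.al_der, hR.al_br⟩
  have hbe : be ∈ bracketAut G D br :=
    ⟨mem_graded_iff_of_even hR.internal be hR.be_even, hR.be_der, hR.be_br⟩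
  have hcomm : Commute al be := LinearEquiv.ext hR.al_be_comm
  set W : R ≃ₗ[ℂ] R := al ^ (k + 1) * be ^ (l - 1) with hW
  obtain ⟨hWG, hWD, hWbr⟩ : W ∈ bracketAut G D br :=
    mul_mem (zpow_mem hal _) (zpow_mem hbe _)
  have hWal : Commute W al :=
    ((Commute.refl al).zpow_left _).mul_left (hcomm.symm.zpow_left _)
  have hWbe : Commute W be :=
    (hcomm.zpow_left _).mul_left ((Commute.refl be).zpow_left _)
  have hbeW : al ^ (k + 1) * be ^ l = be * W := by
    rw [← hWbe.eq, hW, mul_assoc, ← zpow_add_one, sub_add_cancel]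
  have hWal' : ∀ b, W (al b) = al (W b) := LinearEquiv.congr_fun hWal.eq
  have hWbe' : ∀ b, W (be b) = be (W b) := LinearEquiv.congr_fun hWbe.eq
  have hbr_al : ∀ n x y, al (br n x y) = br n (al x) (al y) := hR.al_br
  have hbr_be : ∀ n x y, be (br n x y) = br n (be x) (be y) := hR.be_br
  refine ⟨fun n b => ?_, fun n b => ?_, fun n b => ?_, fun j j' m n b c hb _ => ?_⟩
  · simp only [hF, hWD, hR.sesq₂]
  · rw [hF, hF, hbr_al, haα, hWal']
  · rw [hF, hF, hbr_be, haβ, hWbe']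
  · have hJ := hR.jacobi i₀ j m n a (W b) (W c) ha ((hWG j b).2 hb)
    simp only [LinearEquiv.coe_coe, haα, haβ] at hJ
    simp only [hF, hWbr, hbeW, LinearEquiv.mul_apply]
    exact hJ
end
end
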